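/- arXiv:cs/0411008 — 2 statements merged into one kernel-verified Lean document; each statement's English description precedes it below -/
import Mathlib

section
/- For all m, k ≥ 0 and pairwise distinct general atoms R₁,…,R_m, P, Q, S₁,…,S_k, T, the formula (R₁∧…∧R_m∧P∧Q∧S₁∧…∧S_k → T) → (R₁∧…∧R_m∧Q∧P∧S₁∧…∧S_k → T) is provable in CL2. -/
/-- CL2-formulas: logical atoms ⊤/⊥, elementary atoms, general atoms,
negation, n-ary ∧, ∨, ⊓, ⊔ (arities other than ≥2 never arise in derivations
of proper formulas). -/
inductive CL2 : Type where
  | top : CL2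
  | bot : CL2
  | elem : Nat → CL2
  | gen : Nat → CL2
  | neg : CL2 → CL2
  | land : List CL2 → CL2
  | lor : List CL2 → CL2
  | chand : List CL2 → CL2
  | chor : List CL2 → CL2

namespace CL2

/-- Elementarization (with a polarity parameter): surface ⊓ becomes ⊤, surface ⊔
becomes ⊥, positive surface general atoms become ⊥, negative ones ⊤. -/
def elz (pos : Bool) : CL2 → CL2
  | top => top
  | bot => bot
  | elem n => elem n
  | gen _ => if pos then bot else top
  | neg F => neg (elz (!pos) F)
  | land l => land (l.attach.map (fun x => elz pos x.1))
  | lor l => lor (l.attach.map (fun x => elz pos x.1))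
  | chand _ => top
  | chor _ => bot
termination_by F => sizeOf F
decreasing_by
  all_goals simp_wf
  all_goals first
    | omega
    | (have h := List.sizeOf_lt_of_mem x.2; omega)

/-- Classical evaluation (used on elementarizations, which contain no
general atoms and no ⊓/⊔). -/
def eval (v : Nat → Bool) : CL2 → Bool
  | top => true
  | bot => false
  | elem n => v n
  | gen _ => false
  | neg F => !(eval v F)
  | land l => (l.attach.map (fun x => eval v x.1)).all id
  | lor l => (l.attach.map (fun x => eval v x.1)).any id
  | chand _ => true
  | chor _ => false
termination_by F => sizeOf F
decreasing_by
  all_goals simp_wf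
  all_goals first
    | omega
    | (have h := List.sizeOf_lt_of_mem x.2; omega)

/-- F is stable iff its elementarization is a classical tautology. -/
def Stable (F : CL2) : Prop := ∀ v : Nat → Bool, eval v (elz true F) = true

/-- Whether the elementary atom `p` occurs (anywhere) in a formula. -/
def elemOccurs (p : Nat) : CL2 → Bool
  | top => false
  | bot => false
  | elem n => n == p
  | gen _ => false
  | neg F => elemOccurs p F
  | land l => (l.attach.map (fun x => elemOccurs p x.1)).any id
  | lor l => (l.attach.map (fun x => elemOccurs p x.1)).any id
  | chand l => (l.attach.map (fun x => elemOccurs p x.1)).any id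
  | chor l => (l.attach.map (fun x => elemOccurs p x.1)).any id
termination_by F => sizeOf F
decreasing_by
  all_goals simp_wf
  all_goals first
    | omega
    | (have h := List.sizeOf_lt_of_mem x.2; omega)

end CL2

/-- One-hole surface contexts: the hole is not in the scope of ⊓ or ⊔. -/
inductive SCtx : Type where
  | hole : SCtx
  | neg : SCtx → SCtx
  | land : List CL2 → SCtx → List CL2 → SCtx
  | lor : List CL2 → SCtx → List CL2 → SCtx

namespace SCtx

def fill : SCtx → CL2 → CL2
  | hole, F => F
  | neg C, F => CL2.neg (fill C F)
  | land l C r, F => CL2.land (l ++ fill C F :: r)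
  | lor l C r, F => CL2.lor (l ++ fill C F :: r)

/-- Number of negations the hole is in the scope of. -/
def negCount : SCtx → Nat
  | hole => 0
  | neg C => negCount C + 1
  | land _ C _ => negCount C
  | lor _ C _ => negCount C

end SCtx

/-- Two-hole surface contexts (the two holes are distinct surface occurrences,
so their least common ancestor is an ∧- or ∨-node). -/
inductive DCtx : Type where
  | neg : DCtx → DCtx
  | land : List CL2 → DCtx → List CL2 → DCtx
  | lor : List CL2 → DCtx → List CL2 → DCtx
  | landS : List CL2 → SCtx → List CL2 → SCtx → List CL2 → DCtx
  | lorS : List CL2 → SCtx → List CL2 → SCtx → List CL2 → DCtx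

namespace DCtx

def fill2 : DCtx → CL2 → CL2 → CL2
  | neg D, A, B => CL2.neg (fill2 D A B)
  | land l D r, A, B => CL2.land (l ++ fill2 D A B :: r)
  | lor l D r, A, B => CL2.lor (l ++ fill2 D A B :: r)
  | landS l C1 m C2 r, A, B => CL2.land (l ++ C1.fill A :: m ++ C2.fill B :: r)
  | lorS l C1 m C2 r, A, B => CL2.lor (l ++ C1.fill A :: m ++ C2.fill B :: r)

def negCount1 : DCtx → Nat
  | neg D => negCount1 D + 1
  | land _ D _ => negCount1 D
  | lor _ D _ => negCount1 D
  | landS _ C1 _ _ _ => C1.negCount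
  | lorS _ C1 _ _ _ => C1.negCount

def negCount2 : DCtx → Nat
  | neg D => negCount2 D + 1
  | land _ D _ => negCount2 D
  | lor _ D _ => negCount2 D
  | landS _ _ _ C2 _ => C2.negCount
  | lorS _ _ _ C2 _ => C2.negCount

end DCtx

/-- The premises of Rule (a) with conclusion `F`: results of replacing a positive
surface occurrence of a ⊓-subformula, or a negative surface occurrence of a
⊔-subformula, by one of its components. -/
def PremiseA (F H : CL2) : Prop :=
  ∃ (C : SCtx) (Gs : List CL2) (i : Fin Gs.length),
    (Even C.negCount ∧ F = C.fill (CL2.chand Gs) ∧ H = C.fill (Gs.get i)) ∨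
    (Odd C.negCount ∧ F = C.fill (CL2.chor Gs) ∧ H = C.fill (Gs.get i))

/-- The premise of Rule (b): `H` results from replacing in `F` a negative surface
occurrence of a ⊓-subformula, or a positive surface occurrence of a ⊔-subformula,
by one of its components. -/
def PremiseB (F H : CL2) : Prop :=
  ∃ (C : SCtx) (Gs : List CL2) (i : Fin Gs.length),
    (Odd C.negCount ∧ F = C.fill (CL2.chand Gs) ∧ H = C.fill (Gs.get i)) ∨
    (Even C.negCount ∧ F = C.fill (CL2.chor Gs) ∧ H = C.fill (Gs.get i))

/-- The premise of Rule (c): `H` results from replacing in `F` two — one positive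
and one negative — surface occurrences of a general atom by an elementary atom
not occurring in `F`. -/
def PremiseC (F H : CL2) : Prop :=
  ∃ (D : DCtx) (P p : Nat),
    F = D.fill2 (CL2.gen P) (CL2.gen P) ∧
    H = D.fill2 (CL2.elem p) (CL2.elem p) ∧
    ((Even D.negCount1 ∧ Odd D.negCount2) ∨ (Odd D.negCount1 ∧ Even D.negCount2)) ∧
    CL2.elemOccurs p F = false

/-- CL2-provability. -/
inductive Provable : CL2 → Prop where
  | ruleA (F : CL2) : CL2.Stable F → (∀ H, PremiseA F H → Provable H) → Provable F
  | ruleB (F H : CL2) : PremiseB F H → Provable H → Provable F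
  | ruleC (F H : CL2) : PremiseC F H → Provable H → Provable F

/-- Implication: F → G abbreviates ¬F ∨ G. -/
def CL2.imp (F G : CL2) : CL2 := CL2.lor [CL2.neg F, G]

/-- `conjImp [F₁,…,Fₙ] T` is F₁∧…∧Fₙ → T, with the conventions that for n = 1 it
is F₁ → T and for n = 0 it is T. -/
def conjImp (l : List CL2) (t : CL2) : CL2 :=
  match l with
  | [] => t
  | [f] => CL2.imp f t
  | l => CL2.imp (CL2.land l) t

/-- `conj1 [F₁,…,Fₙ]` is F₁∧…∧Fₙ, with the convention that for n = 1 it is F₁. -/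
def conj1 (l : List CL2) : CL2 :=
  match l with
  | [f] => f
  | l => CL2.land l

namespace CL2

lemma elz_land (b : Bool) (l : List CL2) : elz b (land l) = land (l.map (elz b)) := by
  rw [elz, List.attach_map_val]

lemma elz_lor (b : Bool) (l : List CL2) : elz b (lor l) = lor (l.map (elz b)) := by
  rw [elz, List.attach_map_val]

lemma eval_land (v : Nat → Bool) (l : List CL2) : eval v (land l) = l.all (eval v) := by
  rw [eval, List.attach_map_val, List.all_map, Function.id_comp]

lemma eval_lor (v : Nat → Bool) (l : List CL2) : eval v (lor l) = l.any (eval v) := by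
  rw [eval, List.attach_map_val, List.any_map, Function.id_comp]

lemma elemOccurs_land (p : Nat) (l : List CL2) :
    elemOccurs p (land l) = l.any (elemOccurs p) := by
  rw [elemOccurs, List.attach_map_val, List.any_map, Function.id_comp]

lemma elemOccurs_lor (p : Nat) (l : List CL2) :
    elemOccurs p (lor l) = l.any (elemOccurs p) := by
  rw [elemOccurs, List.attach_map_val, List.any_map, Function.id_comp]

/-- Formulas without surface occurrences of choice operators. -/
inductive ChoiceFree : CL2 → Prop where
  | elem (n : Nat) : ChoiceFree (elem n)
  | neg {F : CL2} : ChoiceFree F → ChoiceFree (neg F)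
  | land {l : List CL2} : (∀ F ∈ l, ChoiceFree F) → ChoiceFree (land l)
  | lor {l : List CL2} : (∀ F ∈ l, ChoiceFree F) → ChoiceFree (lor l)

lemma ChoiceFree.of_fill {C : SCtx} {G : CL2} (h : ChoiceFree (C.fill G)) : ChoiceFree G := by
  induction C with
  | hole => exact h
  | neg C ih => cases h with | neg h => exact ih h
  | land l C r ih => cases h with | land h => exact ih (h _ (by simp))
  | lor l C r ih => cases h with | lor h => exact ih (h _ (by simp))

lemma ChoiceFree.imp {F G : CL2} (hF : ChoiceFree F) (hG : ChoiceFree G) :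
    ChoiceFree (imp F G) :=
  .lor (by simp [hF.neg, hG])

lemma ChoiceFree.provable {F : CL2} (h : ChoiceFree F) (hs : Stable F) : Provable F := by
  refine .ruleA F hs ?_
  rintro H ⟨C, Gs, i, ⟨-, rfl, -⟩ | ⟨-, rfl, -⟩⟩ <;> cases h.of_fill

lemma elemOccurs_imp (p : Nat) (F G : CL2) :
    elemOccurs p (imp F G) = (elemOccurs p F || elemOccurs p G) := by
  simp [imp, elemOccurs_lor, elemOccurs]

lemma eval_elz_imp (v : Nat → Bool) (b : Bool) (F G : CL2) :
    eval v (elz b (imp F G)) = (!eval v (elz (!b) F) || eval v (elz b G)) := by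
  simp [imp, elz_lor, eval_lor, elz, eval]

lemma eval_elz_land (v : Nat → Bool) (b : Bool) (l : List CL2) :
    eval v (elz b (land l)) = l.all fun F => eval v (elz b F) := by
  rw [elz_land, eval_land, List.all_map]; rfl

end CL2

open CL2

lemma exists_eq_append_of_perm_cons {α : Type*} {a : α} {l r : List α} (h : l.Perm (a :: r)) :
    ∃ l₁ l₂, l = l₁ ++ a :: l₂ ∧ (l₁ ++ l₂).Perm r := by
  obtain ⟨l₁, l₂, rfl⟩ := List.append_of_mem (h.mem_iff.2 List.mem_cons_self)
  exact ⟨l₁, l₂, rfl, (List.perm_middle.symm.trans h).cons_inv⟩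

lemma elemOccurs_land_of_perm {p : Nat} {gs es : List Nat} {A : List CL2}
    (hA : A.Perm (gs.map gen ++ es.map elem)) (hp : p ∉ es) :
    elemOccurs p (land A) = false := by
  rw [elemOccurs_land, hA.any_eq]
  simp only [List.any_append, List.any_map, Bool.or_eq_false_iff, List.any_eq_false,
    Function.comp_apply, elemOccurs]
  exact ⟨by simp, fun e he h => hp (by simpa [← eq_of_beq h] using he)⟩

/-- Two conjunctions of the same atoms are interchangeable as antecedents. -/
lemma provable_imp_imp_of_perm (t : Nat) (gs es : List Nat) (A B : List CL2)
    (hA : A.Perm (gs.map gen ++ es.map elem)) (hB : B.Perm (gs.map gen ++ es.map elem)) :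
    Provable (imp (imp (land A) (elem t)) (imp (land B) (elem t))) := by
  induction gs generalizing es A B with
  | nil =>
    rw [List.map_nil, List.nil_append] at hA hB
    have free {l : List CL2} (hl : l.Perm (es.map elem)) : ChoiceFree (land l) :=
      .land fun F hF => by
        obtain ⟨e, -, rfl⟩ := List.mem_map.1 (hl.mem_iff.1 hF)
        exact .elem e
    refine (((free hA).imp (.elem t)).imp ((free hB).imp (.elem t))).provable fun v => ?_
    have helem (b : Bool) (n : Nat) : elz b (elem n) = elem n := by rw [elz]
    simp only [eval_elz_imp, eval_elz_land, hA.all_eq, hB.all_eq, List.all_map,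
      Function.comp_def, helem]
    generalize es.all _ = a
    cases a <;> cases eval v (elem t) <;> rfl
  | cons g gs ih =>
    obtain ⟨p, hp⟩ := (t :: es).toFinset.exists_notMem
    simp only [List.mem_toFinset, List.mem_cons, not_or] at hp
    have hocc : elemOccurs p (imp (imp (land A) (elem t)) (imp (land B) (elem t))) = false := by
      simp [elemOccurs_imp, elemOccurs_land_of_perm hA hp.2, elemOccurs_land_of_perm hB hp.2,
        elemOccurs, Ne.symm hp.1]
    obtain ⟨A₁, A₂, rfl, hA'⟩ := exists_eq_append_of_perm_cons hA
    obtain ⟨B₁, B₂, rfl, hB'⟩ := exists_eq_append_of_perm_cons hB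
    have extend {l₁ l₂ : List CL2} (hl : (l₁ ++ l₂).Perm (gs.map gen ++ es.map elem)) :
        (l₁ ++ elem p :: l₂).Perm (gs.map gen ++ (p :: es).map elem) :=
      List.perm_middle.trans ((hl.cons _).trans List.perm_middle.symm)
    refine .ruleC _ _ ⟨.lorS [] (.neg (.lor [] (.neg (.land A₁ .hole A₂)) [elem t])) []
      (.lor [] (.neg (.land B₁ .hole B₂)) [elem t]) [], g, p, rfl, rfl, .inl ?_, hocc⟩
      (ih (p :: es) _ _ (extend hA') (extend hB'))
    exact ⟨even_two, odd_one⟩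

lemma conjImp_of_two_le_length {l : List CL2} (h : 2 ≤ l.length) (t : CL2) :
    conjImp l t = imp (land l) t := by
  match l, h with
  | _ :: _ :: _, _ => rfl

/-- Lemma 8(a): for all m, k ≥ 0 and pairwise distinct general atoms
R₁,…,R_m, P, Q, S₁,…,S_k, T, the formula
(R₁∧…∧R_m∧P∧Q∧S₁∧…∧S_k → T) → (R₁∧…∧R_m∧Q∧P∧S₁∧…∧S_k → T) is provable in CL2. -/
theorem cl2_provable_exchange (m k : Nat) (R : Fin m → Nat) (P Q : Nat) (S : Fin k → Nat)
    (T : Nat)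
    (hdist : (List.ofFn R ++ P :: Q :: (List.ofFn S ++ [T])).Nodup) :
    Provable (CL2.imp
      (conjImp ((List.ofFn R).map CL2.gen ++
        CL2.gen P :: CL2.gen Q :: (List.ofFn S).map CL2.gen) (CL2.gen T))
      (conjImp ((List.ofFn R).map CL2.gen ++
        CL2.gen Q :: CL2.gen P :: (List.ofFn S).map CL2.gen) (CL2.gen T))) := by
  rw [conjImp_of_two_le_length (by simp; omega), conjImp_of_two_le_length (by simp; omega)]
  set A := (List.ofFn R).map gen ++ gen P :: gen Q :: (List.ofFn S).map gen with hA
  set B := (List.ofFn R).map gen ++ gen Q :: gen P :: (List.ofFn S).map gen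
  set gs := List.ofFn R ++ P :: Q :: List.ofFn S with hgs
  have hAg : A.Perm (gs.map gen ++ ([] : List Nat).map elem) := by simp [hA, hgs]
  have hBg : B.Perm (gs.map gen ++ ([] : List Nat).map elem) :=
    .trans (.append_left _ (.swap _ _ _)) hAg
  refine .ruleC _ _ ⟨.lorS [] (.neg (.lor [neg (land A)] .hole [])) []
    (.lor [neg (land B)] .hole []) [], T, 0, rfl, rfl, .inr ⟨odd_one, Even.zero⟩, ?_⟩
    (provable_imp_imp_of_perm 0 gs [] A B hAg hBg)
  simp [elemOccurs_imp, elemOccurs_land_of_perm hAg, elemOccurs_land_of_perm hBg, elemOccurs]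
end

section
/- For all m ≥ 0 and pairwise distinct general atoms R₁,…,R_m, P, T, the formula (R₁∧…∧R_m → T) → (R₁∧…∧R_m∧P → T) is provable in CL2. -/
/-- Formulas without any occurrence of ⊓ or ⊔. -/
inductive CL2.ChoiceFree_s2 : CL2 → Prop where
  | elem (n : Nat) : ChoiceFree_s2 (CL2.elem n)
  | gen (n : Nat) : ChoiceFree_s2 (CL2.gen n)
  | neg {F : CL2} : ChoiceFree_s2 F → ChoiceFree_s2 (CL2.neg F)
  | land {l : List CL2} : (∀ F ∈ l, ChoiceFree_s2 F) → ChoiceFree_s2 (CL2.land l)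
  | lor {l : List CL2} : (∀ F ∈ l, ChoiceFree_s2 F) → ChoiceFree_s2 (CL2.lor l)

theorem CL2.ChoiceFree_s2.of_fill {A : CL2} (C : SCtx) (h : (C.fill A).ChoiceFree_s2) :
    A.ChoiceFree_s2 := by
  induction C with
  | hole => exact h
  | neg C ih => cases h with | neg h => exact ih h
  | land l C r ih => cases h with | land h => exact ih (h _ (by simp))
  | lor l C r ih => cases h with | lor h => exact ih (h _ (by simp))

/-- A stable formula without choice operators follows by Rule (a) from no premises. -/
theorem Provable.of_stable {F : CL2} (hF : F.ChoiceFree_s2) (hs : F.Stable) : Provable F := by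
  refine Provable.ruleA F hs ?_
  rintro H ⟨C, Gs, i, ⟨-, rfl, -⟩ | ⟨-, rfl, -⟩⟩
  · cases hF.of_fill
  · cases hF.of_fill

/-- The formula (A → t) → (B → t). -/
def CL2.impImp (A B t : CL2) : CL2 := CL2.imp (CL2.imp A t) (CL2.imp B t)

theorem CL2.ChoiceFree_s2.impImp {A B t : CL2} (hA : A.ChoiceFree_s2) (hB : B.ChoiceFree_s2)
    (ht : t.ChoiceFree_s2) : (CL2.impImp A B t).ChoiceFree_s2 := by
  have imp {F G : CL2} (hF : F.ChoiceFree_s2) (hG : G.ChoiceFree_s2) : (CL2.imp F G).ChoiceFree_s2 :=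
    .lor (by simp [hF.neg, hG])
  exact imp (imp hA ht) (imp hB ht)

/-- Rule (c) applied to the two occurrences of the succedent in (A → T) → (B → T). -/
theorem Provable.impImp_of_elem {A B : CL2} (T p : Nat) (hA : A.elemOccurs p = false)
    (hB : B.elemOccurs p = false) (h : Provable (CL2.impImp A B (CL2.elem p))) :
    Provable (CL2.impImp A B (CL2.gen T)) := by
  refine Provable.ruleC _ _ ⟨.lorS [] (.neg (.lor [A.neg] .hole [])) []
    (.lor [B.neg] .hole []) [], T, p, rfl, rfl, Or.inr ⟨?_, ?_⟩, ?_⟩ h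
  · simp [DCtx.negCount1, SCtx.negCount]
  · simp [DCtx.negCount2, SCtx.negCount]
  · simp [CL2.impImp, CL2.imp, CL2.elemOccurs, hA, hB]

/-- Rule (c) applied to a general atom having a positive occurrence in each antecedent of
(A → t) → (B → t). -/
theorem Provable.impImp_fill_of_elem (C D : SCtx) (t : CL2) (Q p : Nat)
    (hC : Even C.negCount) (hD : Even D.negCount)
    (hCp : (C.fill (CL2.gen Q)).elemOccurs p = false)
    (hDp : (D.fill (CL2.gen Q)).elemOccurs p = false) (ht : t.elemOccurs p = false)
    (h : Provable (CL2.impImp (C.fill (CL2.elem p)) (D.fill (CL2.elem p)) t)) :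
    Provable (CL2.impImp (C.fill (CL2.gen Q)) (D.fill (CL2.gen Q)) t) := by
  refine Provable.ruleC _ _ ⟨.lorS [] (.neg (.lor [] (.neg C) [t])) []
    (.lor [] (.neg D) [t]) [], Q, p, rfl, rfl, Or.inl ⟨?_, ?_⟩, ?_⟩ h
  · simpa [DCtx.negCount1, SCtx.negCount, Nat.even_add_one] using hC
  · exact hD.add_one
  · simp [CL2.impImp, CL2.imp, CL2.elemOccurs, hCp, hDp, ht]

/-- Weakening for conjunctions some of whose general atoms have already been replaced by
elementary ones. -/
theorem Provable.land_weakening (P t : Nat) (rs es : List Nat) :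
    Provable (CL2.impImp (CL2.land (es.map CL2.elem ++ rs.map CL2.gen))
      (CL2.land (es.map CL2.elem ++ rs.map CL2.gen ++ [CL2.gen P])) (CL2.elem t)) := by
  induction rs generalizing es with
  | nil =>
    refine Provable.of_stable (.impImp (.land ?_) (.land ?_) (.elem t)) fun v => ?_
    · simp only [List.mem_append, List.mem_map]
      rintro F (⟨n, -, rfl⟩ | h)
      · exact .elem n
      · simp at h
    · simp only [List.mem_append, List.mem_map]
      rintro F ((⟨n, -, rfl⟩ | h) | h)
      · exact .elem n
      · simp at h
      · rw [List.mem_singleton.1 h]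
        exact .gen P
    · simp [CL2.impImp, CL2.imp, CL2.elz, CL2.eval]
      grind
  | cons r rs ih =>
    obtain ⟨p, hp⟩ := Infinite.exists_notMem_finset (insert t es.toFinset)
    have hp' : ¬ t = p ∧ ∀ x ∈ es, ¬ x = p := by
      simp only [Finset.mem_insert, List.mem_toFinset, not_or] at hp
      exact ⟨fun h => hp.1 h.symm, fun x hx h => hp.2 (h ▸ hx)⟩
    have key := Provable.impImp_fill_of_elem (.land (es.map CL2.elem) .hole (rs.map CL2.gen))
      (.land (es.map CL2.elem) .hole (rs.map CL2.gen ++ [CL2.gen P])) (CL2.elem t) r p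
      (by simp [SCtx.negCount]) (by simp [SCtx.negCount])
      (by simpa [SCtx.fill, CL2.elemOccurs] using hp'.2)
      (by simpa [SCtx.fill, CL2.elemOccurs] using hp'.2)
      (by simpa [CL2.elemOccurs] using hp'.1)
      (by simpa [SCtx.fill] using ih (es ++ [p]))
    simpa [SCtx.fill] using key

/-- Lemma 8(b): for all m ≥ 0 and pairwise distinct general atoms R₁,…,R_m, P, T,
the formula (R₁∧…∧R_m → T) → (R₁∧…∧R_m∧P → T) is provable in CL2. -/
theorem cl2_provable_weakening (m : Nat) (R : Fin m → Nat) (P T : Nat)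
    (hdist : (List.ofFn R ++ [P, T]).Nodup) :
    Provable (CL2.imp
      (conjImp ((List.ofFn R).map CL2.gen) (CL2.gen T))
      (conjImp ((List.ofFn R).map CL2.gen ++ [CL2.gen P]) (CL2.gen T))) := by
  clear hdist
  generalize List.ofFn R = rs
  match rs with
  | [] =>
    refine Provable.ruleC _ (CL2.imp (CL2.elem 0) (CL2.imp (CL2.gen P) (CL2.elem 0)))
      ⟨.lorS [] (.neg .hole) [] (.lor [(CL2.gen P).neg] .hole []) [], T, 0, rfl, rfl,
        Or.inr ⟨?_, ?_⟩, ?_⟩ (.of_stable (.lor ?_) fun v => ?_)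
    · simp [DCtx.negCount1, SCtx.negCount]
    · simp [DCtx.negCount2, SCtx.negCount]
    · simp [conjImp, CL2.imp, CL2.elemOccurs]
    · have h : (CL2.imp (CL2.gen P) (CL2.elem 0)).ChoiceFree_s2 :=
        .lor (by simp [CL2.ChoiceFree_s2.elem, CL2.ChoiceFree_s2.neg, CL2.ChoiceFree_s2.gen])
      simp [h, CL2.ChoiceFree_s2.elem, CL2.ChoiceFree_s2.neg]
    · simp [CL2.imp, CL2.elz, CL2.eval]
  | [r] =>
    refine Provable.impImp_of_elem T 0 (by simp [CL2.elemOccurs]) (by simp [CL2.elemOccurs]) ?_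
    refine Provable.impImp_fill_of_elem .hole (.land [] .hole [CL2.gen P]) (CL2.elem 0) r 1
      (by simp [SCtx.negCount]) (by simp [SCtx.negCount]) (by simp [SCtx.fill, CL2.elemOccurs])
      (by simp [SCtx.fill, CL2.elemOccurs]) (by simp [CL2.elemOccurs]) ?_
    refine Provable.of_stable (.impImp (.elem 1) (.land ?_) (.elem 0)) fun v => ?_
    · simp [SCtx.fill, CL2.ChoiceFree_s2.elem, CL2.ChoiceFree_s2.gen]
    · simp [CL2.impImp, CL2.imp, SCtx.fill, CL2.elz, CL2.eval]
      cases v 0 <;> simp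
  | r :: s :: rs =>
    refine Provable.impImp_of_elem T 0 (by simp [CL2.elemOccurs]) (by simp [CL2.elemOccurs]) ?_
    exact Provable.land_weakening P 0 (r :: s :: rs) []
end
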